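/- Let p be a prime with p ≥ 3, let R be a noetherian complete local ring with maximal ideal 𝔪 and perfect residue field k of characteristic p, let 𝔟 ⊆ 𝔪 be an ideal with 𝔟² = 0, and set R' = R/𝔟 and Ĩ = 𝕀_R + Ŵ(𝔟) ⊆ 𝕎(R). Then: (i) addition on Ŵ(𝔟) is coordinatewise, and the map f̃₁ : Ĩ → 𝕎(R) defined by f̃₁(a + x) = v⁻¹(a) + shift(x) for a ∈ 𝕀_R and x ∈ Ŵ(𝔟), where shift((b₀,b₁,b₂,…)) = (b₁,b₂,…), is a well-defined f-linear map extending v⁻¹ : 𝕀_R → 𝕎(R); (ii) f̃₁ is the unique f-linear extension of v⁻¹ to Ĩ with f̃₁([b]) = 0 for every Teichmüller representative [b], b ∈ 𝔟; and (iii) 𝓕' = (𝕎(R), Ĩ, R', f, f̃₁) is a frame. -/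

import Mathlib

open scoped BigOperators

/-- A frame `(S, I, R, f, f₁)` (with `R = S ⧸ I` implicit):
`S` is a local ring, `I ⊆ S` an ideal, `f` a ring endomorphism of `S`,
`f₁ : I → S` an `f`-linear map such that `f₁(I)` generates `S` as an `S`-module. -/
structure Frame (S : Type) [CommRing S] where
  isLocal : IsLocalRing S
  I : Ideal S
  f : S →+* S
  f₁ : I →ₛₗ[f] S
  span_f₁ : Ideal.span (Set.range ⇑f₁) = ⊤

/-- A window `(P, Q, F, F₁)` over a frame. -/
structure IsWindow {S : Type} [CommRing S] (𝓕 : Frame S)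
    {P : Type} [AddCommGroup P] [Module S P] [Module.Free S P] [Module.Finite S P]
    (Q : Submodule S P) (F : P →ₛₗ[𝓕.f] P) (F₁ : Q →ₛₗ[𝓕.f] P) : Prop where
  smul_le : 𝓕.I • (⊤ : Submodule S P) ≤ Q
  quot_free : ∃ n : ℕ, Nonempty ((P ⧸ Q) ≃ₗ[S] (Fin n → S ⧸ 𝓕.I))
  F₁_smul : ∀ (a : 𝓕.I) (x : P),
    F₁ ⟨(a : S) • x, smul_le (Submodule.smul_mem_smul a.2 Submodule.mem_top)⟩
      = 𝓕.f₁ a • F x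
  span_F₁ : Submodule.span S (Set.range ⇑F₁) = ⊤

open WittVector in
/-- `x ∈ Ŵ(𝔟)`: all coefficients of the Witt vector `x` lie in `𝔟` and converge to zero
`𝔪`-adically (for every `n`, all but finitely many coefficients lie in `𝔪^n`). -/
def MemHatW (p : ℕ) [Fact p.Prime] {R : Type} [CommRing R] (𝔪 𝔟 : Ideal R)
    (x : WittVector p R) : Prop :=
  (∀ i, x.coeff i ∈ 𝔟) ∧ ∀ n : ℕ, ∀ᶠ i in Filter.atTop, x.coeff i ∈ 𝔪 ^ n

open WittVector in
/-- `T` is the subring `𝕎(R) ⊆ W(R)`: it is stable under the Frobenius, maps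
surjectively onto `W(k)` under the projection (induced by the residue map `ρ : R → k`),
and the kernel of `T → W(k)` is `Ŵ(𝔪)`. -/
def IsSpecialSubring (p : ℕ) [Fact p.Prime] {R k : Type} [CommRing R] [CommRing k]
    (𝔪 : Ideal R) (ρ : R →+* k) (T : Subring (WittVector p R)) : Prop :=
  (∀ x ∈ T, frobenius x ∈ T) ∧
  (∀ y : WittVector p k, ∃ x ∈ T, WittVector.map ρ x = y) ∧
  (∀ x : WittVector p R, (x ∈ T ∧ WittVector.map ρ x = 0) ↔ MemHatW p 𝔪 𝔪 x)

namespace WittVector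

variable {p : ℕ} [Fact p.Prime] {R : Type*} [CommRing R]

theorem map_quotientMk_eq_zero_iff (I : Ideal R) (x : WittVector p R) :
    map (Ideal.Quotient.mk I) x = 0 ↔ ∀ i, x.coeff i ∈ I := by
  simp only [WittVector.ext_iff, map_coeff, zero_coeff, Ideal.Quotient.eq_zero_iff_mem]

theorem teichmuller_coeff_mem {I : Ideal R} {r : R} (hr : r ∈ I) (i : ℕ) :
    (teichmuller p r).coeff i ∈ I := by
  obtain rfl | hi := i.eq_zero_or_pos
  · simpa using hr
  · simp [teichmuller_coeff_pos p r i hi]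

theorem map_frobenius {S : Type*} [CommRing S] (g : R →+* S) (x : WittVector p R) :
    map g (frobenius x) = frobenius (map g x) := by
  ext n
  simp_rw [map_coeff, coeff_frobenius, MvPolynomial.map_aeval, funext (map_coeff g _),
    RingHom.ext_int _ (algebraMap ℤ S), MvPolynomial.aeval_eq_eval₂Hom]

theorem frobenius_coeff_mem {I : Ideal R} {x : WittVector p R} (hx : ∀ i, x.coeff i ∈ I) (i : ℕ) :
    (frobenius x).coeff i ∈ I := by
  revert i
  rw [← map_quotientMk_eq_zero_iff, map_frobenius, (map_quotientMk_eq_zero_iff I x).2 hx, map_zero]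

/-- The Frobenius raises Teichmüller representatives to the `p`-th power. -/
theorem frobenius_teichmuller (r : R) :
    frobenius (teichmuller p r) = teichmuller p (r ^ p) := by
  have hQ : frobenius (teichmuller p (Polynomial.X : Polynomial ℚ)) =
      teichmuller p (Polynomial.X ^ p) := by
    have hp : IsUnit (p : ℚ) := (Nat.cast_ne_zero.2 (Fact.out : p.Prime).ne_zero).isUnit
    have : Invertible (p : Polynomial ℚ) := by
      simpa using (hp.map Polynomial.C).invertible
    apply (ghostMap.bijective_of_invertible p (Polynomial ℚ)).1
    ext1 n
    simp only [ghostMap_apply, ghostComponent_frobenius, ghostComponent_teichmuller]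
    ring
  have hZ : frobenius (teichmuller p (Polynomial.X : Polynomial ℤ)) =
      teichmuller p (Polynomial.X ^ p) := by
    apply map_injective (Polynomial.mapRingHom (Int.castRingHom ℚ))
      (Polynomial.map_injective _ Int.cast_injective)
    simpa [map_frobenius, map_teichmuller] using hQ
  simpa [map_frobenius, map_teichmuller] using
    congrArg (map (Polynomial.eval₂RingHom (Int.castRingHom R) r)) hZ

theorem teichmuller_add_verschiebung_shift (x : WittVector p R) :
    teichmuller p (x.coeff 0) + verschiebung (x.shift 1) = x := by
  ext n
  rw [coeff_add_of_disjoint]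
  · cases n with
    | zero => simp
    | succ n => simp [teichmuller_coeff_pos, shift_coeff, add_comm]
  · intro n
    cases n with
    | zero => right; simp
    | succ n => left; simp [teichmuller_coeff_pos]

theorem verschiebung_mem_ker_truncate {n : ℕ} {x : WittVector p R}
    (hx : x ∈ RingHom.ker (truncate n : WittVector p R →+* _)) :
    verschiebung x ∈ RingHom.ker (truncate (n + 1) : WittVector p R →+* _) := by
  rw [mem_ker_truncate] at hx ⊢
  intro i hi
  cases i with
  | zero => simp
  | succ i => simpa using hx i (by lia)

theorem mul_eq_zero_of_coeff_mem {I J : Ideal R} (hIJ : I * J = ⊥) {x y : WittVector p R}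
    (hx : ∀ i, x.coeff i ∈ I) (hy : ∀ i, y.coeff i ∈ J) : x * y = 0 := by
  suffices h : ∀ (n : ℕ) (x y : WittVector p R), (∀ i, x.coeff i ∈ I) → (∀ i, y.coeff i ∈ J) →
      x * y ∈ RingHom.ker (truncate n : WittVector p R →+* _) by
    ext n
    rw [zero_coeff]
    exact (mem_ker_truncate _ _).1 (h (n + 1) x y hx hy) n (by lia)
  intro n
  induction n with
  | zero => intro x y _ _; exact (mem_ker_truncate _ _).2 (by simp)
  | succ n ih =>
    intro x y hx hy
    have hx' : ∀ i, (x.shift 1).coeff i ∈ I := fun i => hx _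
    have hy' : ∀ i, (y.shift 1).coeff i ∈ J := fun i => hy _
    have hxy : x.coeff 0 * y.coeff 0 = 0 := by
      simpa [hIJ] using Ideal.mul_mem_mul (hx 0) (hy 0)
    have key : x * y =
        verschiebung (x.shift 1 * frobenius (teichmuller p (y.coeff 0))) +
        verschiebung (frobenius (teichmuller p (x.coeff 0)) * y.shift 1) +
        verschiebung (x.shift 1 * y.shift 1 * (p : WittVector p R)) := by
      rw [mul_assoc, ← frobenius_verschiebung, verschiebung_mul_frobenius,
        verschiebung_mul_frobenius, mul_comm (frobenius _), verschiebung_mul_frobenius]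
      conv_lhs => rw [← teichmuller_add_verschiebung_shift x,
        ← teichmuller_add_verschiebung_shift y]
      have : teichmuller p (x.coeff 0) * teichmuller p (y.coeff 0) = 0 := by
        rw [← map_mul, hxy, teichmuller_zero]
      linear_combination this
    rw [key]
    refine add_mem (add_mem ?_ ?_) ?_ <;> apply verschiebung_mem_ker_truncate
    · exact ih _ _ hx' (frobenius_coeff_mem (teichmuller_coeff_mem (hy 0)))
    · exact ih _ _ (frobenius_coeff_mem (teichmuller_coeff_mem (hx 0))) hy'
    · exact Ideal.mul_mem_right _ _ (ih _ _ hx' hy')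

theorem mul_coeff_mem {I J : Ideal R} {x y : WittVector p R}
    (hx : ∀ i, x.coeff i ∈ I) (hy : ∀ i, y.coeff i ∈ J) (i : ℕ) :
    (x * y).coeff i ∈ I * J := by
  revert i
  rw [← map_quotientMk_eq_zero_iff, map_mul]
  refine mul_eq_zero_of_coeff_mem (I := I.map (Ideal.Quotient.mk (I * J)))
    (J := J.map (Ideal.Quotient.mk (I * J))) ?_ (fun i => Ideal.mem_map_of_mem _ (hx i))
    (fun i => Ideal.mem_map_of_mem _ (hy i))
  rw [← Ideal.map_mul, Ideal.map_quotient_self]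

theorem pow_coeff_mem {I : Ideal R} {x : WittVector p R} (hx : ∀ i, x.coeff i ∈ I) (n i : ℕ) :
    (x ^ n).coeff i ∈ I ^ n := by
  induction n generalizing i with
  | zero => simp
  | succ n ih => rw [pow_succ, pow_succ]; exact mul_coeff_mem ih hx i

open MvPolynomial in
theorem wittAdd_sub_mem (n : ℕ) :
    wittAdd p n - X (0, n) - X (1, n) ∈ idealOfVars (Fin 2 × ℕ) ℤ ^ 2 := by
  have hX : ∀ i, X i ∈ idealOfVars (Fin 2 × ℕ) ℤ := fun i => Ideal.subset_span ⟨i, rfl⟩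
  have hφ : ∀ i, wittAdd p i ∈ idealOfVars (Fin 2 × ℕ) ℤ := fun i => by
    rw [← pow_one (idealOfVars _ _), mem_pow_idealOfVars_iff']
    intro d hd
    obtain rfl : d = 0 := by
      rwa [Nat.lt_one_iff, Finsupp.degree_eq_zero_iff] at hd
    exact constantCoeff_wittAdd p i
  have hpow : ∀ f ∈ idealOfVars (Fin 2 × ℕ) ℤ, ∀ m ≠ 0,
      f ^ p ^ m ∈ idealOfVars (Fin 2 × ℕ) ℤ ^ 2 := fun f hf m hm =>
    Ideal.pow_le_pow_right
      ((Fact.out : p.Prime).two_le.trans (Nat.le_self_pow hm p)) (Ideal.pow_mem_pow hf _)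
  have hsum : (p : MvPolynomial (Fin 2 × ℕ) ℤ) ^ n * (wittAdd p n - X (0, n) - X (1, n)) ∈
      idealOfVars (Fin 2 × ℕ) ℤ ^ 2 := by
    have h := wittStructureInt_prop p (X 0 + X 1 : MvPolynomial (Fin 2) ℤ) n
    rw [wittPolynomial_eq_sum_C_mul_X_pow] at h
    simp only [map_sum, map_mul, map_pow, map_add, bind₁_X_right, rename_X, bind₁_C_right,
      rename_C, Finset.sum_range_succ, Nat.sub_self, pow_zero, pow_one] at h
    change _ + _ * wittAdd p n = _ at h
    have h' : (p : MvPolynomial (Fin 2 × ℕ) ℤ) ^ n * (wittAdd p n - X (0, n) - X (1, n)) =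
        ∑ i ∈ Finset.range n, C ((p : ℤ) ^ i) * X (0, i) ^ p ^ (n - i) +
        ∑ i ∈ Finset.range n, C ((p : ℤ) ^ i) * X (1, i) ^ p ^ (n - i) -
        ∑ i ∈ Finset.range n, C ((p : ℤ) ^ i) * wittAdd p i ^ p ^ (n - i) := by
      simp only [map_pow, map_natCast] at h ⊢
      unfold wittAdd at *
      linear_combination h
    rw [h']
    refine sub_mem (add_mem ?_ ?_) ?_ <;>
      refine sum_mem fun i hi => Ideal.mul_mem_left _ _ (hpow _ ?_ _ ?_) <;>
      first | exact hX _ | exact hφ _ | (have := Finset.mem_range.1 hi; lia)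
  rw [mem_pow_idealOfVars_iff'] at hsum ⊢
  intro d hd
  have := hsum d hd
  rw [← map_natCast C, ← map_pow, coeff_C_mul, mul_eq_zero] at this
  exact this.resolve_left (pow_ne_zero _ (by simp [(Fact.out : p.Prime).ne_zero]))

theorem add_coeff_of_sq_eq_bot {I : Ideal R} (hI : I * I = ⊥) {x y : WittVector p R}
    (hx : ∀ i, x.coeff i ∈ I) (hy : ∀ i, y.coeff i ∈ I) (n : ℕ) :
    (x + y).coeff n = x.coeff n + y.coeff n := by
  let e : MvPolynomial (Fin 2 × ℕ) ℤ →ₐ[ℤ] R :=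
    MvPolynomial.aeval (Function.uncurry ![x.coeff, y.coeff])
  have he : (MvPolynomial.idealOfVars (Fin 2 × ℕ) ℤ).map e ≤ I := by
    rw [Ideal.map_le_iff_le_comap, Ideal.span_le]
    rintro _ ⟨⟨i, j⟩, rfl⟩
    fin_cases i
    · simpa [e] using hx j
    · simpa [e] using hy j
  have h : e (wittAdd p n - MvPolynomial.X (0, n) - MvPolynomial.X (1, n)) ∈ I ^ 2 := by
    refine Ideal.pow_right_mono he 2 ?_
    rw [← Ideal.map_pow]
    exact Ideal.mem_map_of_mem _ (wittAdd_sub_mem n)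
  rw [sq, hI, Ideal.mem_bot, map_sub, map_sub, sub_sub, sub_eq_zero] at h
  rw [add_coeff]
  simpa [e, peval] using h

theorem shift_add_of_coeff_zero_mem {I : Ideal R} (hI : I * I = ⊥) {x y : WittVector p R}
    (hx : x.coeff 0 ∈ I) (hy : y.coeff 0 ∈ I) :
    (x + y).shift 1 = x.shift 1 + y.shift 1 := by
  have h : teichmuller p ((x + y).coeff 0) =
      teichmuller p (x.coeff 0) + teichmuller p (y.coeff 0) := by
    ext n
    rw [add_coeff_of_sq_eq_bot hI (teichmuller_coeff_mem hx) (teichmuller_coeff_mem hy)]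
    cases n <;> simp [teichmuller_coeff_pos, add_coeff_zero]
  apply verschiebung_injective p R
  rw [map_add]
  linear_combination teichmuller_add_verschiebung_shift (x + y) -
    teichmuller_add_verschiebung_shift x - teichmuller_add_verschiebung_shift y - h

theorem shift_mul_of_coeff_zero_mem {I : Ideal R} (hI : I * I = ⊥) (s : WittVector p R)
    {x : WittVector p R} (hx : x.coeff 0 ∈ I) :
    (s * x).shift 1 = frobenius s * x.shift 1 := by
  have hpow : x.coeff 0 ^ p = 0 := by
    refine pow_eq_zero_of_le (Fact.out : p.Prime).two_le ?_
    rw [sq]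
    simpa [hI] using Ideal.mul_mem_mul hx hx
  have h : teichmuller p ((s * x).coeff 0) = s * teichmuller p (x.coeff 0) := by
    conv_rhs => rw [← teichmuller_add_verschiebung_shift s]
    rw [add_mul, ← map_mul, ← verschiebung_mul_frobenius, frobenius_teichmuller, hpow,
      teichmuller_zero, mul_zero, map_zero, add_zero, mul_coeff_zero]
  apply verschiebung_injective p R
  rw [mul_comm (frobenius s), verschiebung_mul_frobenius]
  linear_combination teichmuller_add_verschiebung_shift (s * x) -
    s * teichmuller_add_verschiebung_shift x - h

theorem pow_dvd_coeff_of_ghostComponent_eq_zero (hp : 3 ≤ p) {x : WittVector p ℤ}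
    (hx0 : (p : ℤ) ∣ x.coeff 0) (hx : ∀ n, 0 < n → ghostComponent n x = 0) (n : ℕ) :
    (p : ℤ) ^ (n + 1) ∣ x.coeff n := by
  induction n using Nat.strong_induction_on with
  | _ n ih =>
  obtain rfl | hn := n.eq_zero_or_pos
  · simpa using hx0
  have h := hx n hn
  rw [ghostComponent_apply, wittPolynomial_eq_sum_C_mul_X_pow, map_sum,
    Finset.sum_range_succ] at h
  simp only [map_mul, map_pow, MvPolynomial.aeval_X, Nat.sub_self, pow_zero,
    pow_one, map_natCast] at h
  have hsum : (p : ℤ) ^ n * (p : ℤ) ^ (n + 1) ∣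
      ∑ i ∈ Finset.range n, (p : ℤ) ^ i * x.coeff i ^ p ^ (n - i) := by
    refine Finset.dvd_sum fun i hi => ?_
    have hi := Finset.mem_range.1 hi
    obtain ⟨j, rfl⟩ := Nat.exists_eq_add_of_lt hi
    have hj : 2 * (j + 1) + 1 ≤ p ^ (j + 1) := by
      refine le_trans ?_ (Nat.pow_le_pow_left hp _)
      have := one_add_mul_le_pow (R := ℤ) (a := 2) (by norm_num) (j + 1)
      zify
      norm_num at this
      linarith
    refine dvd_trans ?_ (mul_dvd_mul_left _ (pow_dvd_pow_of_dvd (ih i hi) _))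
    rw [← pow_mul, ← pow_add, ← pow_add]
    refine pow_dvd_pow _ ?_
    rw [show i + j + 1 - i = j + 1 by lia]
    nlinarith
  have h' : (p : ℤ) ^ n * (p : ℤ) ^ (n + 1) ∣ (p : ℤ) ^ n * x.coeff n := by
    rw [eq_neg_of_add_eq_zero_right h]
    exact (dvd_neg).2 hsum
  exact (mul_dvd_mul_iff_left (pow_ne_zero _ (by simp [(Fact.out : p.Prime).ne_zero]))).1 h'

theorem verschiebung_one_sub_natCast_coeff_mem (hp : 3 ≤ p) {I : Ideal R} (hpI : (p : R) ∈ I)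
    (n : ℕ) : (verschiebung (1 : WittVector p R) - (p : WittVector p R)).coeff n ∈ I ^ (n + 1) := by
  have h0 : (p : ℤ) ∣ (verschiebung (1 : WittVector p ℤ) - (p : WittVector p ℤ)).coeff 0 := by
    rw [← constantCoeff_apply, map_sub, map_natCast]
    simp [constantCoeff_apply]
  have h := pow_dvd_coeff_of_ghostComponent_eq_zero hp h0 (fun n hn => by
    obtain ⟨m, rfl⟩ := Nat.exists_eq_add_of_lt hn
    rw [map_sub, zero_add, ghostComponent_verschiebung, map_one, map_natCast]
    simp) n
  obtain ⟨c, hc⟩ := h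
  have hmap : verschiebung (1 : WittVector p R) - (p : WittVector p R) =
      map (Int.castRingHom R) (verschiebung (1 : WittVector p ℤ) - (p : WittVector p ℤ)) := by
    rw [map_sub, map_verschiebung, map_one (map _), map_natCast]
  rw [hmap, map_coeff, hc]
  simpa using Ideal.mul_mem_right _ _ (Ideal.pow_mem_pow hpI (n + 1))

theorem eq_of_map_quotientMk_pow_eq (I : Ideal R) [IsHausdorff I R] {x y : WittVector p R}
    (h : ∀ n, map (Ideal.Quotient.mk (I ^ n)) x = map (Ideal.Quotient.mk (I ^ n)) y) : x = y := by
  ext i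
  rw [← sub_eq_zero]
  refine IsHausdorff.haus' (I := I) _ fun n => ?_
  have := congrArg (coeff · i) (h n)
  simp only [map_coeff, Ideal.Quotient.eq] at this
  rw [SModEq.zero]
  simpa using this

theorem exists_map_quotientMk_pow_eq (I : Ideal R) [IsPrecomplete I R] (s : ℕ → WittVector p R)
    (hs : ∀ n, map (Ideal.Quotient.mk (I ^ n)) (s (n + 1)) = map (Ideal.Quotient.mk (I ^ n)) (s n)) :
    ∃ y, ∀ n, map (Ideal.Quotient.mk (I ^ n)) y = map (Ideal.Quotient.mk (I ^ n)) (s n) := by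
  have hcauchy : ∀ i, ∃ L, ∀ n, (s n).coeff i ≡ L [SMOD (I ^ n • ⊤ : Submodule R R)] := by
    refine fun i => IsPrecomplete.prec' _ fun {m n} hmn => ?_
    rw [Ideal.smul_eq_mul, Ideal.mul_top]
    induction n, hmn using Nat.le_induction with
    | base => rfl
    | succ n hmn ih =>
      refine ih.trans (SModEq.mono (Ideal.pow_le_pow_right hmn) ?_)
      have := congrArg (coeff · i) (hs n)
      simp only [map_coeff, Ideal.Quotient.eq] at this
      exact (SModEq.sub_mem.2 this).symm
  choose L hL using hcauchy
  refine ⟨mk p L, fun n => ?_⟩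
  ext i
  have := SModEq.sub_mem.1 (hL i n).symm
  simp only [map_coeff, Ideal.Quotient.eq]
  simpa using this

theorem exists_one_add_mul_eq_one (I : Ideal R) [IsAdicComplete I R] {z : WittVector p R}
    (hz : ∀ i, z.coeff i ∈ I) :
    ∃ y, (1 + z) * y = 1 ∧ ∀ n, map (Ideal.Quotient.mk (I ^ n)) y =
      map (Ideal.Quotient.mk (I ^ n)) (∑ i ∈ Finset.range n, (-z) ^ i) := by
  have hpow : ∀ n, map (Ideal.Quotient.mk (I ^ n)) ((-z) ^ n) = 0 := fun n => by
    rw [neg_pow, map_mul, (map_quotientMk_eq_zero_iff _ _).2 (pow_coeff_mem hz n), mul_zero]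
  obtain ⟨y, hy⟩ := exists_map_quotientMk_pow_eq I (fun n => ∑ i ∈ Finset.range n, (-z) ^ i)
    fun n => by rw [Finset.sum_range_succ, map_add, hpow, add_zero]
  refine ⟨y, eq_of_map_quotientMk_pow_eq I fun n => ?_, hy⟩
  rw [map_mul, hy, ← map_mul, ← sub_neg_eq_add, mul_neg_geom_sum, map_sub, hpow, sub_zero]

end WittVector

section TildeIdeal

open WittVector

variable {p : ℕ} [Fact p.Prime] {R : Type} [CommRing R] {𝔪 𝔟 : Ideal R}

theorem memHatW_teichmuller {r : R} (hr : r ∈ 𝔟) :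
    MemHatW p 𝔪 𝔟 (teichmuller p r) :=
  ⟨teichmuller_coeff_mem hr, fun n => (Filter.eventually_gt_atTop 0).mono fun i hi => by
    simp [teichmuller_coeff_pos p r i hi]⟩

theorem memHatW_verschiebung_iff {x : WittVector p R} :
    MemHatW p 𝔪 𝔟 (verschiebung x) ↔ MemHatW p 𝔪 𝔟 x := by
  refine and_congr ⟨fun h i => by simpa using h (i + 1), fun h i => ?_⟩ (forall_congr' fun n => ?_)
  · cases i <;> simp [h]
  · conv_lhs => rw [← Filter.map_add_atTop_eq_nat 1, Filter.eventually_map]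
    simp only [verschiebung_coeff_add_one]

/-- The kernel `{x ∈ T | x₀ ∈ 𝔟}` of the projection `T → R ⧸ 𝔟`. -/
noncomputable def tildeIdeal (T : Subring (WittVector p R)) (𝔟 : Ideal R) : Ideal T :=
  RingHom.ker (((Ideal.Quotient.mk 𝔟).comp constantCoeff).comp T.subtype)

theorem mem_tildeIdeal {T : Subring (WittVector p R)} {x : T} :
    x ∈ tildeIdeal T 𝔟 ↔ (x : WittVector p R).coeff 0 ∈ 𝔟 :=
  Ideal.Quotient.eq_zero_iff_mem

end TildeIdeal

namespace IsSpecialSubring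

open WittVector IsLocalRing

variable {p : ℕ} [Fact p.Prime] {R k : Type} [CommRing R] [IsLocalRing R] [Field k]
  {ρ : R →+* k} {T : Subring (WittVector p R)}

theorem mem_of_memHatW (hT : IsSpecialSubring p (maximalIdeal R) ρ T) {x : WittVector p R}
    (hx : MemHatW p (maximalIdeal R) (maximalIdeal R) x) : x ∈ T :=
  ((hT.2.2 x).2 hx).1

theorem memHatW_sub (hT : IsSpecialSubring p (maximalIdeal R) ρ T) {x y : WittVector p R}
    (hx : x ∈ T) (hy : y ∈ T) (h : map ρ x = map ρ y) :
    MemHatW p (maximalIdeal R) (maximalIdeal R) (x - y) :=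
  (hT.2.2 _).1 ⟨sub_mem hx hy, by rw [map_sub, h, sub_self]⟩

theorem teichmuller_mem (hT : IsSpecialSubring p (maximalIdeal R) ρ T) {r : R}
    (hr : r ∈ maximalIdeal R) : teichmuller p r ∈ T :=
  hT.mem_of_memHatW (memHatW_teichmuller hr)

theorem verschiebung_one_mem (hT : IsSpecialSubring p (maximalIdeal R) ρ T) (hp : 3 ≤ p)
    (hpR : (p : R) ∈ maximalIdeal R) : verschiebung (1 : WittVector p R) ∈ T := by
  have h := verschiebung_one_sub_natCast_coeff_mem hp hpR
  have hmem : verschiebung (1 : WittVector p R) - (p : WittVector p R) ∈ T := by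
    refine hT.mem_of_memHatW ⟨fun i => Ideal.pow_le_self i.succ_ne_zero (h i), fun n => ?_⟩
    filter_upwards [Filter.eventually_ge_atTop n] with i hi
    exact Ideal.pow_le_pow_right (by lia) (h i)
  simpa using add_mem hmem (natCast_mem T p)

theorem verschiebung_mem [CharP k p] [PerfectRing k p]
    (hT : IsSpecialSubring p (maximalIdeal R) ρ T) (hp : 3 ≤ p)
    (hpR : (p : R) ∈ maximalIdeal R) {x : WittVector p R} (hx : x ∈ T) : verschiebung x ∈ T := by
  obtain ⟨y, hy⟩ := (frobenius_bijective p k).2 (map ρ x)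
  obtain ⟨c, hc, rfl⟩ := hT.2.1 y
  have h := hT.memHatW_sub hx (hT.1 c hc) (by rw [map_frobenius, hy])
  have h1 : verschiebung (frobenius c) ∈ T := by
    have := verschiebung_mul_frobenius 1 c
    rw [one_mul] at this
    rw [this]
    exact mul_mem (hT.verschiebung_one_mem hp hpR) hc
  have h2 := add_mem (hT.mem_of_memHatW (memHatW_verschiebung_iff.2 h)) h1
  rwa [← map_add, sub_add_cancel] at h2

theorem mem_of_verschiebung_mem [CharP k p] [PerfectRing k p]
    (hT : IsSpecialSubring p (maximalIdeal R) ρ T) (hp : 3 ≤ p)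
    (hpR : (p : R) ∈ maximalIdeal R) {x : WittVector p R} (hx : verschiebung x ∈ T) : x ∈ T := by
  obtain ⟨c, hc, hcx⟩ := hT.2.1 (map ρ x)
  have h := hT.memHatW_sub hx (hT.verschiebung_mem hp hpR hc)
    (by rw [map_verschiebung, map_verschiebung, hcx])
  rw [← map_sub, memHatW_verschiebung_iff] at h
  simpa using add_mem (hT.mem_of_memHatW h) hc

theorem shift_mem [CharP k p] [PerfectRing k p]
    (hT : IsSpecialSubring p (maximalIdeal R) ρ T) (hp : 3 ≤ p)
    (hpR : (p : R) ∈ maximalIdeal R) {x : WittVector p R} (hx : x ∈ T)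
    (hx0 : x.coeff 0 ∈ maximalIdeal R) : x.shift 1 ∈ T := by
  refine hT.mem_of_verschiebung_mem hp hpR ?_
  rw [eq_sub_of_add_eq' (teichmuller_add_verschiebung_shift x)]
  exact sub_mem hx (hT.teichmuller_mem hx0)

theorem exists_coeff_zero_eq (hT : IsSpecialSubring p (maximalIdeal R) ρ T)
    (hker : RingHom.ker ρ = maximalIdeal R) (r : R) : ∃ x ∈ T, x.coeff 0 = r := by
  obtain ⟨t, ht, htr⟩ := hT.2.1 (teichmuller p (ρ r))
  have h0 : t.coeff 0 - r ∈ maximalIdeal R := by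
    rw [← hker, RingHom.mem_ker, map_sub, ← map_coeff, htr, teichmuller_coeff_zero, sub_self]
  refine ⟨t - teichmuller p (t.coeff 0 - r), sub_mem ht (hT.teichmuller_mem h0), ?_⟩
  rw [← constantCoeff_apply, map_sub, constantCoeff_apply, constantCoeff_apply,
    teichmuller_coeff_zero, sub_sub_cancel]

theorem exists_mul_eq_one [IsAdicComplete (maximalIdeal R) R] [CharP k p]
    (hT : IsSpecialSubring p (maximalIdeal R) ρ T) {x : WittVector p R} (hx : x ∈ T)
    (hx0 : IsUnit (x.coeff 0)) : ∃ y ∈ T, x * y = 1 := by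
  obtain ⟨w, hw⟩ := (isUnit_of_coeff_zero_ne_zero (map ρ x)
    (by simpa using (hx0.map ρ).ne_zero)).exists_right_inv
  obtain ⟨c, hc, rfl⟩ := hT.2.1 w
  have hz := hT.memHatW_sub (mul_mem hx hc) (one_mem T) (by rw [map_mul, hw, map_one])
  set z := x * c - 1 with hzdef
  have hzT := hT.mem_of_memHatW hz
  have hρz := ((hT.2.2 z).2 hz).2
  obtain ⟨y, hy, hyn⟩ := exists_one_add_mul_eq_one (maximalIdeal R) hz.1
  have hs : ∀ n, MemHatW p (maximalIdeal R) (maximalIdeal R)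
      (∑ i ∈ Finset.range (n + 1), (-z) ^ i - 1) := fun n =>
    hT.memHatW_sub (sum_mem fun i _ => pow_mem (neg_mem hzT) i) (one_mem T) (by
      simp [Finset.sum_range_succ', hρz])
  have hmod : ∀ n i, (y - 1).coeff i - (∑ i ∈ Finset.range (n + 1), (-z) ^ i - 1).coeff i ∈
      maximalIdeal R ^ (n + 1) := fun n i => by
    rw [← Ideal.Quotient.eq, ← map_coeff, ← map_coeff, map_sub, map_sub, hyn]
  have hyT : y - 1 ∈ T := by
    refine hT.mem_of_memHatW ⟨fun i => ?_, fun n => ?_⟩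
    · have h := hmod 0 i
      rw [zero_add, pow_one] at h
      simpa only [sub_add_cancel] using add_mem h ((hs 0).1 i)
    · filter_upwards [(hs n).2 n] with i hi
      simpa using add_mem (Ideal.pow_le_pow_right n.le_succ (hmod n i)) hi
  refine ⟨c * y, mul_mem hc (by simpa using add_mem hyT (one_mem T)), ?_⟩
  rw [← hy, hzdef]
  ring

theorem isLocalRing [IsAdicComplete (maximalIdeal R) R] [CharP k p]
    (hT : IsSpecialSubring p (maximalIdeal R) ρ T) : IsLocalRing T := by
  have hunit : ∀ x : T, IsUnit ((x : WittVector p R).coeff 0) → IsUnit x := fun x hx => by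
    obtain ⟨y, hy, hxy⟩ := hT.exists_mul_eq_one x.2 hx
    exact IsUnit.of_mul_eq_one ⟨y, hy⟩ (Subtype.ext hxy)
  refine IsLocalRing.of_isUnit_or_isUnit_one_sub_self fun x => ?_
  refine (isUnit_or_isUnit_one_sub_self ((x : WittVector p R).coeff 0)).imp (hunit x) fun h => ?_
  refine hunit _ ?_
  rw [AddSubgroupClass.coe_sub, OneMemClass.coe_one, ← constantCoeff_apply, map_sub, map_one]
  exact h

/-- The frame structure on `T = 𝕎(R)` with ideal `{x | x₀ ∈ 𝔟}`, the Witt vector Frobenius, and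
the coordinate shift. -/
noncomputable def tildeFrame [IsAdicComplete (maximalIdeal R) R] [CharP k p] [PerfectRing k p]
    (hT : IsSpecialSubring p (maximalIdeal R) ρ T) (hp : 3 ≤ p) (hpR : (p : R) ∈ maximalIdeal R)
    {𝔟 : Ideal R} (h𝔟 : 𝔟 ≤ maximalIdeal R) (hsq : 𝔟 * 𝔟 = ⊥) : Frame T where
  isLocal := hT.isLocalRing
  I := tildeIdeal T 𝔟
  f := frobenius.restrict T T hT.1
  f₁ :=
    { toFun x := ⟨((x : T) : WittVector p R).shift 1,
        hT.shift_mem hp hpR x.1.2 (h𝔟 (mem_tildeIdeal.1 x.2))⟩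
      map_add' x y := by
        refine Subtype.ext ?_
        exact shift_add_of_coeff_zero_mem hsq (mem_tildeIdeal.1 x.2) (mem_tildeIdeal.1 y.2)
      map_smul' s x := by
        refine Subtype.ext ?_
        exact shift_mul_of_coeff_zero_mem hsq (s : WittVector p R) (mem_tildeIdeal.1 x.2) }
  span_f₁ := by
    rw [Ideal.eq_top_iff_one]
    refine Ideal.subset_span
      ⟨⟨⟨_, hT.verschiebung_one_mem hp hpR⟩, mem_tildeIdeal.2 (by simp)⟩, Subtype.ext ?_⟩
    ext i
    simp [shift_coeff, add_comm 1 i]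

section tildeFrame

variable [IsAdicComplete (maximalIdeal R) R] [CharP k p] [PerfectRing k p]
  (hT : IsSpecialSubring p (maximalIdeal R) ρ T) (hp : 3 ≤ p) (hpR : (p : R) ∈ maximalIdeal R)
  {𝔟 : Ideal R} (h𝔟 : 𝔟 ≤ maximalIdeal R) (hsq : 𝔟 * 𝔟 = ⊥)

theorem mem_tildeFrame_I {x : T} :
    x ∈ (hT.tildeFrame hp hpR h𝔟 hsq).I ↔ (x : WittVector p R).coeff 0 ∈ 𝔟 :=
  mem_tildeIdeal

theorem coe_tildeFrame_f₁ (x : (hT.tildeFrame hp hpR h𝔟 hsq).I) :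
    (((hT.tildeFrame hp hpR h𝔟 hsq).f₁ x : T) : WittVector p R) =
      ((x : T) : WittVector p R).shift 1 :=
  rfl

end tildeFrame

end IsSpecialSubring

set_option synthInstance.maxHeartbeats 1000000 in
set_option maxHeartbeats 1000000 in
open WittVector in
/-- For `𝔟 ⊆ 𝔪` with `𝔟² = 0` and `Ĩ = 𝕀_R + Ŵ(𝔟)`:
(i) addition on `Ŵ(𝔟)` is coordinatewise and `f̃₁ : Ĩ → 𝕎(R)`, given by `v⁻¹` on `𝕀_R`
and by the coordinate shift on `Ŵ(𝔟)`, is a well-defined `f`-linear map;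
(ii) `f̃₁` is the unique `f`-linear extension of `v⁻¹` to `Ĩ` killing all Teichmüller
representatives `[b]`, `b ∈ 𝔟`; (iii) `(𝕎(R), Ĩ, R' = R/𝔟, f, f̃₁)` is a frame. -/
theorem tilde_frame_exists (p : ℕ) [Fact p.Prime] (hp3 : 3 ≤ p)
    (R : Type) [CommRing R] [IsLocalRing R] [IsNoetherianRing R]
    [IsAdicComplete (IsLocalRing.maximalIdeal R) R]
    (k : Type) [Field k] [CharP k p] [PerfectRing k p]
    (ρ : R →+* k) (hρ : Function.Surjective ρ)
    (hker : RingHom.ker ρ = IsLocalRing.maximalIdeal R)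
    (𝔟 : Ideal R) (h𝔟 : 𝔟 ≤ IsLocalRing.maximalIdeal R) (hsq : 𝔟 * 𝔟 = ⊥)
    (T : Subring (WittVector p R))
    (hT : IsSpecialSubring p (IsLocalRing.maximalIdeal R) ρ T) :
    -- (i) addition on `Ŵ(𝔟)` is coordinatewise
    (∀ x y : WittVector p R,
      MemHatW p (IsLocalRing.maximalIdeal R) 𝔟 x →
      MemHatW p (IsLocalRing.maximalIdeal R) 𝔟 y →
      ∀ i, (x + y).coeff i = x.coeff i + y.coeff i) ∧
    -- (i) + (iii): the frame `𝓕' = (𝕎(R), Ĩ, R', f, f̃₁)` exists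
    ∃ 𝓕' : Frame T,
      -- the ideal is `Ĩ = 𝕀_R + Ŵ(𝔟)`
      (∀ x : T, x ∈ 𝓕'.I ↔ ∃ a b : WittVector p R,
        (a ∈ T ∧ a.coeff 0 = 0) ∧ MemHatW p (IsLocalRing.maximalIdeal R) 𝔟 b ∧
        (x : WittVector p R) = a + b) ∧
      -- `S/Ĩ` is canonically `R' = R/𝔟`
      (∃ e : (T ⧸ 𝓕'.I) ≃+* (R ⧸ 𝔟), ∀ x : T,
        e (Ideal.Quotient.mk 𝓕'.I x) = Ideal.Quotient.mk 𝔟 ((x : WittVector p R).coeff 0)) ∧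
      -- `f` is the Frobenius
      (∀ x : T, ((𝓕'.f x : T) : WittVector p R) = frobenius (x : WittVector p R)) ∧
      -- `f̃₁` restricts to `v⁻¹` on `𝕀_R`
      (∀ x : 𝓕'.I, ((x : T) : WittVector p R).coeff 0 = 0 →
        verschiebung ((𝓕'.f₁ x : T) : WittVector p R) = ((x : T) : WittVector p R)) ∧
      -- `f̃₁` is the coordinate shift on `Ŵ(𝔟)`
      (∀ x : 𝓕'.I, MemHatW p (IsLocalRing.maximalIdeal R) 𝔟 ((x : T) : WittVector p R) →
        ∀ i, ((𝓕'.f₁ x : T) : WittVector p R).coeff i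
          = ((x : T) : WittVector p R).coeff (i + 1)) ∧
      -- (ii) `f̃₁` kills the Teichmüller representatives of elements of `𝔟` ...
      (∀ b ∈ 𝔟, ∀ (hmT : (teichmuller p b : WittVector p R) ∈ T)
        (hmI : (⟨teichmuller p b, hmT⟩ : T) ∈ 𝓕'.I),
        𝓕'.f₁ ⟨⟨teichmuller p b, hmT⟩, hmI⟩ = 0) ∧
      -- (ii) ... and is the unique `f`-linear extension of `v⁻¹` with this property
      (∀ 𝓖 : Frame T, 𝓖.I = 𝓕'.I →
        (∀ x : T, ((𝓖.f x : T) : WittVector p R) = frobenius (x : WittVector p R)) →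
        (∀ x : 𝓖.I, ((x : T) : WittVector p R).coeff 0 = 0 →
          verschiebung ((𝓖.f₁ x : T) : WittVector p R) = ((x : T) : WittVector p R)) →
        (∀ b ∈ 𝔟, ∀ (hmT : (teichmuller p b : WittVector p R) ∈ T)
          (hmI : (⟨teichmuller p b, hmT⟩ : T) ∈ 𝓖.I),
          𝓖.f₁ ⟨⟨teichmuller p b, hmT⟩, hmI⟩ = 0) →
        ∀ (x : T) (h1 : x ∈ 𝓕'.I) (h2 : x ∈ 𝓖.I),
          𝓕'.f₁ ⟨x, h1⟩ = 𝓖.f₁ ⟨x, h2⟩) := by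
  have hpR : (p : R) ∈ IsLocalRing.maximalIdeal R := by
    rw [← hker, RingHom.mem_ker, map_natCast, CharP.cast_eq_zero]
  refine ⟨fun x y hx hy => add_coeff_of_sq_eq_bot hsq hx.1 hy.1,
    hT.tildeFrame hp3 hpR h𝔟 hsq, fun x => ?_, ?_, fun x => rfl, fun x hx => ?_,
    fun x _ i => ?_, fun b hb hmT hmI => ?_, fun 𝓖 hI hf hv ht x h1 h2 => ?_⟩
  · rw [hT.mem_tildeFrame_I]
    constructor
    · intro hx
      refine ⟨_, _, ⟨sub_mem x.2 (hT.teichmuller_mem (h𝔟 hx)), ?_⟩, memHatW_teichmuller hx,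
        (sub_add_cancel _ _).symm⟩
      rw [← constantCoeff_apply, map_sub, constantCoeff_apply, constantCoeff_apply,
        teichmuller_coeff_zero, sub_self]
    · rintro ⟨a, b, ⟨-, ha⟩, hb, hx⟩
      rw [hx, add_coeff_zero, ha, zero_add]
      exact hb.1 0
  · have hsurj : Function.Surjective (((Ideal.Quotient.mk 𝔟).comp constantCoeff).comp
        T.subtype) := fun y => by
      obtain ⟨r, rfl⟩ := Ideal.Quotient.mk_surjective y
      obtain ⟨x, hx, rfl⟩ := hT.exists_coeff_zero_eq hker r
      exact ⟨⟨x, hx⟩, rfl⟩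
    exact ⟨RingHom.quotientKerEquivOfSurjective hsurj, fun x => rfl⟩
  · rw [hT.coe_tildeFrame_f₁]
    conv_rhs => rw [← teichmuller_add_verschiebung_shift ((x : T) : WittVector p R), hx,
      teichmuller_zero, zero_add]
  · rw [hT.coe_tildeFrame_f₁, shift_coeff, add_comm]
  · refine Subtype.ext ?_
    rw [hT.coe_tildeFrame_f₁]
    ext i
    simp [shift_coeff, teichmuller_coeff_pos]
  · have hx0 := (hT.mem_tildeFrame_I hp3 hpR h𝔟 hsq).1 h1
    have htT := hT.teichmuller_mem (h𝔟 hx0)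
    have htI : (⟨_, htT⟩ : T) ∈ 𝓖.I := by
      rw [hI, hT.mem_tildeFrame_I]
      simpa using hx0
    have hdecomp := teichmuller_add_verschiebung_shift (x : WittVector p R)
    have hsub : ((x - ⟨_, htT⟩ : T) : WittVector p R) =
        verschiebung ((x : WittVector p R).shift 1) := (eq_sub_of_add_eq' hdecomp).symm
    have h := hv ⟨x - ⟨_, htT⟩, sub_mem h2 htI⟩ (by rw [hsub, verschiebung_coeff_zero])
    rw [hsub] at h
    have hG : 𝓖.f₁ ⟨x, h2⟩ = 𝓖.f₁ ⟨x - ⟨_, htT⟩, sub_mem h2 htI⟩ := by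
      rw [← add_zero (𝓖.f₁ ⟨x - _, _⟩), ← ht _ hx0 htT htI, ← map_add]
      congr 1
      exact Subtype.ext (sub_add_cancel _ _).symm
    rw [hG]
    exact Subtype.ext ((hT.coe_tildeFrame_f₁ hp3 hpR h𝔟 hsq _).trans
      (verschiebung_injective p R h).symm)
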